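/- arXiv:2003.01255 — 2 statements merged into one kernel-verified Lean document; each statement's English description precedes it below -/
import Mathlib

section
/- If T ⊆ ℕ satisfies d̄(T) > 0, then the shift set Σ(T) satisfies d̄(Σ(T)) > 0. -/
open scoped Classical in
/-- The upper asymptotic (natural) density of a set of natural numbers:
`d̄(A) = limsup_{m → ∞} |A ∩ [1, m]| / m`. -/
noncomputable def upperDensity (A : Set ℕ) : ℝ :=
  Filter.atTop.limsup fun m : ℕ =>
    (((Finset.Icc 1 m).filter fun n => n ∈ A).card : ℝ) / (m : ℝ)

/-- The shift set of `T ⊆ ℕ`: `Σ(T) = {i ∈ ℕ : d̄(T ∩ (T + i)) > 0}`. -/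
noncomputable def shiftSet (T : Set ℕ) : Set ℕ :=
  {i : ℕ | 0 < upperDensity (T ∩ ((fun t => t + i) '' T))}

open scoped Classical in
/-- The number of elements of `A` in `[1, m]`. -/
noncomputable def initialCount (A : Set ℕ) (m : ℕ) : ℕ :=
  ((Finset.Icc 1 m).filter fun n => n ∈ A).card

/-- `A` has asymptotic density zero. -/
def HasZeroDensity (A : Set ℕ) : Prop :=
  ∀ ε : ℝ, 0 < ε → ∀ᶠ m : ℕ in Filter.atTop, (initialCount A m : ℝ) ≤ ε * m

lemma initialCount_le (A : Set ℕ) (m : ℕ) : initialCount A m ≤ m := by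
  classical
  simpa [initialCount] using Finset.card_filter_le (Finset.Icc 1 m) fun n => n ∈ A

lemma initialCount_mono {A B : Set ℕ} (h : A ⊆ B) (m : ℕ) :
    initialCount A m ≤ initialCount B m := by
  classical
  exact Finset.card_le_card (Finset.monotone_filter_right _ fun n _ hn => h hn)

lemma initialCount_union_le (A B : Set ℕ) (m : ℕ) :
    initialCount (A ∪ B) m ≤ initialCount A m + initialCount B m := by
  classical
  refine le_trans (Finset.card_le_card ?_) (Finset.card_union_le _ _)
  intro n
  simp only [Finset.mem_filter, Finset.mem_union, Set.mem_union]
  tauto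

lemma initialCount_image_add_le (A : Set ℕ) (i m : ℕ) :
    initialCount ((fun t => t + i) '' A) m ≤ initialCount A m + 1 := by
  classical
  refine le_trans (Finset.card_le_card (t :=
    (insert 0 ((Finset.Icc 1 m).filter fun n => n ∈ A)).image fun t => t + i) ?_)
    (Finset.card_image_le.trans (Finset.card_insert_le _ _))
  intro n hn
  obtain ⟨hn, t, ht, rfl⟩ := Finset.mem_filter.1 hn
  refine Finset.mem_image.2 ⟨t, ?_, rfl⟩
  simp only [Finset.mem_Icc, Finset.mem_insert, Finset.mem_filter] at hn ⊢
  rcases Nat.eq_zero_or_pos t with h | h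
  · exact Or.inl h
  · exact Or.inr ⟨⟨h, by omega⟩, ht⟩

lemma eventually_const_le_mul (C : ℝ) {ε : ℝ} (hε : 0 < ε) :
    ∀ᶠ m : ℕ in Filter.atTop, C ≤ ε * m :=
  (tendsto_natCast_atTop_atTop.const_mul_atTop hε).eventually_ge_atTop C

lemma upperDensity_pos_iff (A : Set ℕ) : 0 < upperDensity A ↔ ¬ HasZeroDensity A := by
  have hdef : upperDensity A =
      Filter.atTop.limsup fun m : ℕ => (initialCount A m : ℝ) / (m : ℝ) := rfl
  have hle : ∀ m : ℕ, (initialCount A m : ℝ) / (m : ℝ) ≤ 1 := fun m =>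
    div_le_one_of_le₀ (by exact_mod_cast initialCount_le A m) (Nat.cast_nonneg m)
  have hnonneg : ∀ m : ℕ, 0 ≤ (initialCount A m : ℝ) / (m : ℝ) := fun m => by positivity
  constructor
  · intro hpos hzero
    refine absurd (le_of_forall_pos_le_add fun ε hε => ?_) (not_le.2 hpos)
    rw [zero_add, hdef]
    refine Filter.limsup_le_of_le
      (Filter.isBoundedUnder_of ⟨0, hnonneg⟩ : Filter.IsBoundedUnder (· ≥ ·) _ _).isCoboundedUnder_le
      ?_
    filter_upwards [hzero ε hε] with m hm
    exact div_le_of_le_mul₀ (Nat.cast_nonneg m) hε.le hm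
  · intro h
    simp only [HasZeroDensity, not_forall] at h
    obtain ⟨ε, hε, h⟩ := h
    refine hε.trans_le ?_
    rw [hdef]
    refine Filter.le_limsup_of_frequently_le
      ((Filter.not_eventually.1 h).mono fun m hm => ?_) (Filter.isBoundedUnder_of ⟨1, hle⟩)
    rw [not_le] at hm
    have hm0 : (0 : ℝ) < m := by
      have : (initialCount A m : ℝ) ≤ m := by exact_mod_cast initialCount_le A m
      have := mul_nonneg hε.le (Nat.cast_nonneg (α := ℝ) m)
      linarith
    exact (le_div_iff₀ hm0).2 hm.le

namespace HasZeroDensity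

lemma mono {A B : Set ℕ} (hB : HasZeroDensity B) (h : A ⊆ B) : HasZeroDensity A := fun ε hε => by
  filter_upwards [hB ε hε] with m hm
  exact le_trans (by exact_mod_cast initialCount_mono h m) hm

lemma union {A B : Set ℕ} (hA : HasZeroDensity A) (hB : HasZeroDensity B) :
    HasZeroDensity (A ∪ B) := fun ε hε => by
  filter_upwards [hA (ε / 2) (half_pos hε), hB (ε / 2) (half_pos hε)] with m hAm hBm
  have : (initialCount (A ∪ B) m : ℝ) ≤ initialCount A m + initialCount B m := by
    exact_mod_cast initialCount_union_le A B m
  linarith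

lemma of_finite {A : Set ℕ} (hA : A.Finite) : HasZeroDensity A := fun ε hε => by
  classical
  filter_upwards [eventually_const_le_mul hA.toFinset.card hε] with m hm
  refine le_trans ?_ hm
  exact_mod_cast Finset.card_le_card fun n hn => hA.mem_toFinset.2 (Finset.mem_filter.1 hn).2

lemma biUnion {ι : Type*} (s : Finset ι) {A : ι → Set ℕ} (h : ∀ i ∈ s, HasZeroDensity (A i)) :
    HasZeroDensity (⋃ i ∈ s, A i) := by
  classical
  induction s using Finset.induction_on with
  | empty => simpa using of_finite Set.finite_empty
  | insert a s _ ih =>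
    rw [Finset.set_biUnion_insert]
    exact (h a (Finset.mem_insert_self a s)).union
      (ih fun i hi => h i (Finset.mem_insert_of_mem hi))

lemma image_add {A : Set ℕ} (hA : HasZeroDensity A) (i : ℕ) :
    HasZeroDensity ((fun t => t + i) '' A) := fun ε hε => by
  filter_upwards [hA (ε / 2) (half_pos hε), eventually_const_le_mul 1 (half_pos hε)] with m hm h1
  have : (initialCount ((fun t => t + i) '' A) m : ℝ) ≤ initialCount A m + 1 := by
    exact_mod_cast initialCount_image_add_le A i m
  linarith

lemma ne_univ {A : Set ℕ} (hA : HasZeroDensity A) : A ≠ Set.univ := by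
  rintro rfl
  obtain ⟨m, hm, hm0⟩ := ((hA (1 / 2) (by norm_num)).and (Filter.eventually_gt_atTop 0)).exists
  have : (0 : ℝ) < m := by exact_mod_cast hm0
  simp only [initialCount, Set.mem_univ, Finset.filter_true, Nat.card_Icc,
    Nat.add_sub_cancel] at hm
  linarith

/-- A set of density zero is disjoint from the difference sets of arbitrarily large finite sets. -/
lemma exists_card_eq {S : Set ℕ} (hS : HasZeroDensity S) (r : ℕ) :
    ∃ F : Finset ℕ, F.card = r ∧ ∀ i ∈ F, ∀ j ∈ F, i < j → j - i ∉ S := by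
  classical
  induction r with
  | zero => exact ⟨∅, by simp⟩
  | succ r ih =>
    obtain ⟨F, hF, hdiff⟩ := ih
    have hzero : HasZeroDensity ((⋃ f ∈ F, (fun t => t + f) '' S) ∪ Set.Iic (F.sup id)) :=
      (biUnion F fun f _ => hS.image_add f).union (of_finite (Set.finite_Iic _))
    obtain ⟨n, hn⟩ := (Set.ne_univ_iff_exists_notMem _).1 hzero.ne_univ
    simp only [Set.mem_union, Set.mem_iUnion, Set.mem_image, Set.mem_Iic, not_or, not_exists,
      not_and, not_le] at hn
    obtain ⟨hn, hgt⟩ := hn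
    have hlt : ∀ f ∈ F, f < n := fun f hf => (Finset.le_sup (f := id) hf).trans_lt hgt
    refine ⟨insert n F, ?_, ?_⟩
    · rw [Finset.card_insert_of_notMem fun h => (hlt n h).false, hF]
    · intro i hi j hj hij
      rcases Finset.mem_insert.1 hi with rfl | hiF <;> rcases Finset.mem_insert.1 hj with rfl | hjF
      · exact (hij.false).elim
      · exact (hij.asymm (hlt j hjF)).elim
      · exact fun h => hn i hiF _ h (Nat.sub_add_cancel hij.le)
      · exact hdiff i hiF j hjF hij

end HasZeroDensity

/-- If the translates of `A` by the elements of `F` are pairwise disjoint, then their counts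
add up to at most the length of an interval containing them. -/
lemma card_mul_initialCount_le {A : Set ℕ} {F : Finset ℕ}
    (h : ∀ i ∈ F, ∀ j ∈ F, i < j → ∀ t ∈ A, t + (j - i) ∉ A) (m : ℕ) :
    F.card * initialCount A m ≤ m + F.sup id := by
  classical
  rw [initialCount, ← Finset.card_product]
  calc _ ≤ (Finset.Icc 1 (m + F.sup id)).card := by
        refine Finset.card_le_card_of_injOn (fun p => p.2 + p.1) ?_ ?_
        · rintro ⟨i, t⟩ hp
          simp only [Finset.coe_product, Set.mem_prod, Finset.mem_coe, Finset.mem_filter,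
            Finset.mem_Icc] at hp ⊢
          have : i ≤ F.sup id := Finset.le_sup (f := id) hp.1
          omega
        · rintro ⟨i, t⟩ hp ⟨j, u⟩ hq heq
          simp only [Finset.coe_product, Set.mem_prod, Finset.mem_coe, Finset.mem_filter] at hp hq heq
          rcases lt_trichotomy i j with hij | rfl | hij
          · refine (h i hp.1 j hq.1 hij u hq.2.2 ?_).elim
            rw [show u + (j - i) = t by omega]
            exact hp.2.2
          · rw [Nat.add_right_cancel heq]
          · refine (h j hq.1 i hp.1 hij t hp.2.2 ?_).elim
            rw [show t + (i - j) = u by omega]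
            exact hq.2.2
    _ = _ := by simp

/-- **Proposition 3.6 of Bell–Hu–Satriano**: if `T ⊆ ℕ` has positive upper asymptotic
density, then so does its shift set `Σ(T)`. -/
theorem shiftSet_pos_density (T : Set ℕ) (hT : 0 < upperDensity T) :
    0 < upperDensity (shiftSet T) := by
  classical
  rw [upperDensity_pos_iff] at hT ⊢
  intro hS
  simp only [HasZeroDensity, not_forall] at hT
  obtain ⟨ε, hε, hT⟩ := hT
  obtain ⟨r, hr⟩ := exists_nat_gt (4 / ε)
  obtain ⟨F, hF, hdiff⟩ := hS.exists_card_eq r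
  set B : Set ℕ := ⋃ p ∈ (F ×ˢ F).filter fun p => p.1 < p.2,
    T ∩ ((fun t => t + (p.2 - p.1)) '' T) with hBdef
  have hB : HasZeroDensity B := by
    refine HasZeroDensity.biUnion _ fun p hp => ?_
    simp only [Finset.mem_filter, Finset.mem_product] at hp
    exact not_not.1 fun h =>
      hdiff p.1 hp.1.1 p.2 hp.1.2 hp.2 ((upperDensity_pos_iff _).2 h)
  have hdisj : ∀ i ∈ F, ∀ j ∈ F, i < j → ∀ t ∈ T \ B, t + (j - i) ∉ T \ B := by
    intro i hi j hj hij t ht hmem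
    refine hmem.2 (Set.mem_biUnion (x := (i, j)) ?_ ⟨hmem.1, t, ht.1, rfl⟩)
    simp [hi, hj, hij]
  obtain ⟨m, hTm, hBm, hm, hm0⟩ := ((Filter.not_eventually.1 hT).and_eventually
    ((hB (ε / 2) (half_pos hε)).and ((Filter.eventually_ge_atTop (F.sup id)).and
      (Filter.eventually_gt_atTop 0)))).exists
  rw [not_le] at hTm
  have hcount : (F.card * initialCount (T \ B) m : ℝ) ≤ m + F.sup id := by
    exact_mod_cast card_mul_initialCount_le hdisj m
  have hsplit : (initialCount T m : ℝ) ≤ initialCount (T \ B) m + initialCount B m := by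
    exact_mod_cast (initialCount_mono (by rw [Set.sdiff_union_self]; exact Set.subset_union_left)
      m).trans (initialCount_union_le (T \ B) B m)
  have hm' : ((F.sup id : ℕ) : ℝ) ≤ m := by exact_mod_cast hm
  have hm0' : (0 : ℝ) < m := by exact_mod_cast hm0
  rw [hF] at hcount
  rw [div_lt_iff₀ hε] at hr
  have hlow : (r : ℝ) * (ε / 2 * m) ≤ r * initialCount (T \ B) m :=
    mul_le_mul_of_nonneg_left (by linarith) (Nat.cast_nonneg r)
  have hmul : 4 * (m : ℝ) < r * ε * m := mul_lt_mul_of_pos_right hr hm0'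
  linarith
end

section
/- Let U be a Noetherian topological space of finite Krull dimension and Φ : U → U a continuous map. Suppose T ⊆ ℕ has positive upper asymptotic density and Z ⊆ U is a closed subset with N_Φ(Z) ≠ ∅. Then there exist infinitely many j ∈ Σ(T) such that ν(Z ∩ Φ^{−j}(Z)) ≺ ν(Z). -/
section TopDyn

variable {U : Type*} [TopologicalSpace U]

/-- A subset `Y` is periodic with respect to `Φ` if `Φ^n(Y) ⊆ Y` for some `n ≥ 1`. -/
def IsPeriodicUnder (Φ : U → U) (Y : Set U) : Prop :=
  ∃ n : ℕ, 1 ≤ n ∧ Φ^[n] '' Y ⊆ Y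

/-- The irreducible components of a closed subset `Z`: the maximal closed irreducible
subsets of `Z`. -/
def irrComps (Z : Set U) : Set (Set U) :=
  {C : Set U | Maximal (fun S => S ⊆ Z ∧ IsIrreducible S ∧ IsClosed S) C}

/-- `P_Φ(Z)`: the unique maximal `Φ`-periodic union of a subcollection of the irreducible
components of `Z` (realized as the union of all `Φ`-periodic unions of subcollections). -/
def PPhi (Φ : U → U) (Z : Set U) : Set U :=
  ⋃₀ {Y : Set U | (∃ S ⊆ irrComps Z, Y = ⋃₀ S) ∧ IsPeriodicUnder Φ Y}

/-- The set of irreducible components of `Z` that are not contained in `P_Φ(Z)`. -/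
def nonPeriodicComps (Φ : U → U) (Z : Set U) : Set (Set U) :=
  {C ∈ irrComps Z | ¬ C ⊆ PPhi Φ Z}

/-- `N_Φ(Z)`: the union of the irreducible components of `Z` not contained in `P_Φ(Z)`. -/
def NPhi (Φ : U → U) (Z : Set U) : Set U :=
  ⋃₀ nonPeriodicComps Φ Z

/-- The stabilized (i.e., limiting, realized as the infimum) value of the weakly decreasing
sequence `dim closure(Φ^n(C))`. -/
noncomputable def stabDim (Φ : U → U) (C : Set U) : WithBot ℕ∞ :=
  ⨅ n : ℕ, topologicalKrullDim ↥(closure (Φ^[n] '' C))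

open scoped Classical in
/-- The stable non-periodic dimension `ν(Z)` of a closed set `Z`: the maximum, in the
lexicographic order (with `⊥` playing the role of `−∞`), of the pairs
`(stabilized dim closure(Φ^n(C)), dim C)` over the irreducible components `C` of `Z` not
contained in `P_Φ(Z)`; it is `(⊥, ⊥)` if there are no such components. -/
noncomputable def nuDim (Φ : U → U) (Z : Set U) : (WithBot ℕ∞) × (WithBot ℕ∞) :=
  let D : WithBot ℕ∞ := ⨆ C ∈ nonPeriodicComps Φ Z, stabDim Φ C
  (D, ⨆ C ∈ nonPeriodicComps Φ Z,
    if stabDim Φ C = D then topologicalKrullDim ↥C else ⊥)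

/-- The lexicographic (strict) order on pairs: `(a, b) ≺ (a', b')` iff `a < a'`, or
`a = a'` and `b < b'`. -/
def nuLt (a b : (WithBot ℕ∞) × (WithBot ℕ∞)) : Prop :=
  a.1 < b.1 ∨ (a.1 = b.1 ∧ a.2 < b.2)

end TopDyn

section DensityHelpers

open Filter Finset

open scoped Classical in
/-- The number of elements of `A` in `[1, m]`. -/
private noncomputable def countUpTo (A : Set ℕ) (m : ℕ) : ℕ :=
  ((Finset.Icc 1 m).filter fun n => n ∈ A).card

private lemma countUpTo_le (A : Set ℕ) (m : ℕ) : countUpTo A m ≤ m := by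
  classical
  simpa [countUpTo] using Finset.card_filter_le (Finset.Icc 1 m) fun n => n ∈ A

private lemma countUpTo_ratio_le_one (A : Set ℕ) (m : ℕ) : (countUpTo A m : ℝ) / m ≤ 1 :=
  div_le_one_of_le₀ (by exact_mod_cast countUpTo_le A m) (by positivity)

private lemma upperDensity_eq (A : Set ℕ) :
    upperDensity A = atTop.limsup fun m : ℕ => (countUpTo A m : ℝ) / m := by
  unfold upperDensity countUpTo
  congr!

private lemma frequently_mul_lt_countUpTo {A : Set ℕ} {δ : ℝ} (h : δ < upperDensity A) :
    ∃ᶠ m : ℕ in atTop, δ * m < countUpTo A m := by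
  rw [upperDensity_eq] at h
  have hb : IsBoundedUnder (· ≥ ·) atTop fun m : ℕ => (countUpTo A m : ℝ) / m :=
    isBoundedUnder_of ⟨0, fun m => by positivity⟩
  have := frequently_lt_of_lt_limsup hb.isCoboundedUnder_le h
  refine (this.and_eventually (eventually_gt_atTop 0)).mono fun m hm => ?_
  rw [← lt_div_iff₀ (by exact_mod_cast hm.2)]
  exact hm.1

private lemma eventually_countUpTo_lt_mul {A : Set ℕ} {ε : ℝ} (h : upperDensity A < ε) :
    ∀ᶠ m : ℕ in atTop, (countUpTo A m : ℝ) < ε * m := by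
  rw [upperDensity_eq] at h
  have hb : IsBoundedUnder (· ≤ ·) atTop fun m : ℕ => (countUpTo A m : ℝ) / m :=
    isBoundedUnder_of ⟨1, countUpTo_ratio_le_one A⟩
  filter_upwards [eventually_lt_of_limsup_lt h hb, eventually_gt_atTop 0] with m hm hm0
  rwa [← div_lt_iff₀ (by exact_mod_cast hm0)]

/-- If the translates of a finite set `A` by `0, q, …, (K - 1) q` have pairwise intersections
of size at most `c`, then `A` cannot be large. -/
private lemma card_mul_le_of_card_inter_le (A : Finset ℕ) (q c K : ℕ)
    (h : ∀ d, 1 ≤ d → d ≤ K → (A ∩ A.image (· + q * d)).card ≤ c) :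
    K * A.card ≤ ((Finset.range K).biUnion fun k => A.image (· + q * k)).card + K ^ 2 * c := by
  induction K with
  | zero => simp
  | succ K ih =>
    have ih := ih fun d h1 h2 => h d h1 (by omega)
    set V := (Finset.range K).biUnion fun k => A.image (· + q * k) with hV
    set B := A.image (· + q * K) with hB
    have hunion : ((Finset.range (K + 1)).biUnion fun k => A.image (· + q * k)) = B ∪ V := by
      rw [Finset.range_add_one, Finset.biUnion_insert]
    have hBcard : B.card = A.card := Finset.card_image_of_injective _ (add_left_injective _)
    have hint : (B ∩ V).card ≤ K * c := by
      rw [hV, Finset.inter_biUnion]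
      refine (Finset.card_biUnion_le_card_mul _ _ c fun k hk => ?_).trans (by simp)
      have hk := Finset.mem_range.1 hk
      refine le_trans ?_ (h (K - k) (by omega) (by omega))
      refine le_trans (Finset.card_le_card ?_)
        (Finset.card_image_le (s := A ∩ A.image (· + q * (K - k))) (f := (· + q * k)))
      intro x hx
      simp only [hB, Finset.mem_inter, Finset.mem_image] at hx ⊢
      obtain ⟨⟨a, ha, rfl⟩, b, hb, hab⟩ := hx
      have hsplit : q * K = q * (K - k) + q * k := by
        rw [← Nat.mul_add]; congr 1; omega
      exact ⟨b, ⟨hb, a, ha, by omega⟩, hab⟩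
    have hc := Finset.card_union_add_card_inter B V
    rw [hunion]
    nlinarith

private lemma exists_mul_mem_shiftSet {T : Set ℕ} (hT : 0 < upperDensity T) (q : ℕ) :
    ∃ d, 1 ≤ d ∧ q * d ∈ shiftSet T := by
  classical
  by_contra! hcon
  set δ := upperDensity T / 2 with hδ
  have hδ0 : 0 < δ := by positivity
  obtain ⟨K, hK⟩ := exists_nat_gt (3 / δ)
  have hKδ : 3 < K * δ := (div_lt_iff₀ hδ0).1 hK
  have hK0 : (0 : ℝ) < K := lt_trans (by positivity) hK
  have hsmall : ∀ᶠ m : ℕ in atTop, ∀ d ∈ Finset.Icc 1 K,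
      (countUpTo (T ∩ ((fun t => t + q * d) '' T)) m : ℝ) < 1 / (K : ℝ) ^ 2 * m := by
    refine (Filter.eventually_all_finset _).2 fun d hd => eventually_countUpTo_lt_mul ?_
    have := hcon d (Finset.mem_Icc.1 hd).1
    simp only [shiftSet, Set.mem_ofPred_eq, not_lt] at this
    exact this.trans_lt (by positivity)
  obtain ⟨m, hm, hsm, hmq⟩ := ((frequently_mul_lt_countUpTo (show δ < upperDensity T by
    rw [hδ]; linarith)).and_eventually
      (hsmall.and (eventually_ge_atTop (q * K)))).exists
  set A := (Finset.Icc 1 m).filter fun n => n ∈ T with hA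
  have hAm : A.card = countUpTo T m := by unfold countUpTo; congr!
  set c := ⌊1 / (K : ℝ) ^ 2 * m⌋₊ with hc
  have hcle : (c : ℝ) ≤ 1 / (K : ℝ) ^ 2 * m := Nat.floor_le (by positivity)
  have key := card_mul_le_of_card_inter_le A q c K fun d h1 h2 => by
    have h3 := hsm d (Finset.mem_Icc.2 ⟨h1, h2⟩)
    refine le_trans ?_ (Nat.le_floor h3.le)
    unfold countUpTo
    refine Finset.card_le_card fun x hx => ?_
    simp only [hA, Finset.mem_inter, Finset.mem_image, Finset.mem_filter] at hx ⊢
    obtain ⟨⟨hx1, hx2⟩, a, ⟨_, ha⟩, rfl⟩ := hx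
    exact ⟨hx1, hx2, a, ha, rfl⟩
  have hsub : ((Finset.range K).biUnion fun k => A.image (· + q * k)).card ≤ m + q * K := by
    refine le_trans (Finset.card_le_card (t := Finset.Icc 1 (m + q * K)) fun x hx => ?_) (by simp)
    simp only [hA, Finset.mem_biUnion, Finset.mem_range, Finset.mem_image, Finset.mem_filter,
      Finset.mem_Icc] at hx ⊢
    obtain ⟨k, hk, a, ⟨⟨h1, h2⟩, _⟩, rfl⟩ := hx
    have := Nat.mul_le_mul_left q hk.le
    omega
  have key' : (K : ℝ) * A.card ≤ (m + q * K) + (K : ℝ) ^ 2 * c := by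
    exact_mod_cast key.trans (Nat.add_le_add_right hsub _)
  have h1 : (K : ℝ) ^ 2 * c ≤ m := by
    calc (K : ℝ) ^ 2 * c ≤ (K : ℝ) ^ 2 * (1 / (K : ℝ) ^ 2 * m) := by gcongr
      _ = (m : ℝ) := by field_simp
  have h2 : (q : ℝ) * K ≤ m := by exact_mod_cast hmq
  rw [hAm] at key'
  have h3 : (K : ℝ) * (δ * m) < K * countUpTo T m := by gcongr
  have h4 : (3 : ℝ) * m ≤ K * δ * m := by gcongr
  linarith

/-- The shift set of a set of positive upper density contains infinitely many multiples of every
positive integer. -/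
private lemma infinite_dvd_mem_shiftSet {T : Set ℕ} (hT : 0 < upperDensity T) {n : ℕ}
    (hn : 1 ≤ n) : {j ∈ shiftSet T | n ∣ j}.Infinite := by
  refine Set.infinite_of_not_bddAbove fun ⟨B, hB⟩ => ?_
  obtain ⟨d, hd, hmem⟩ := exists_mul_mem_shiftSet hT (n * (B + 1))
  have h1 : n * (B + 1) * d ≤ B := hB ⟨hmem, Dvd.intro _ (mul_assoc n (B + 1) d).symm⟩
  have h2 : 1 * (B + 1) * 1 ≤ n * (B + 1) * d := by gcongr
  omega

end DensityHelpers

section DimensionHelpers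

open TopologicalSpace

variable {U : Type*} [TopologicalSpace U]

private lemma topologicalKrullDim_mono {A B : Set U} (h : A ⊆ B) :
    topologicalKrullDim A ≤ topologicalKrullDim B :=
  (Topology.IsEmbedding.inclusion h).isInducing.topologicalKrullDim_le

private lemma topologicalKrullDim_eq_height (A : IrreducibleCloseds U) :
    topologicalKrullDim (A : Set U) = Order.height A := by
  rw [Order.height_eq_krullDim_Iic]
  apply le_antisymm
  · refine Order.krullDim_le_of_strictMono (fun S => ⟨S.map Subtype.val continuous_subtype_val, ?_⟩)
      fun S S' h => IrreducibleCloseds.map_strictMono_of_isInducing Topology.IsInducing.subtypeVal h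
    exact closure_minimal (by rintro _ ⟨x, -, rfl⟩; exact x.2) A.isClosed
  · have him : ∀ S : Set.Iic A, Subtype.val '' ((↑) ⁻¹' (S.1 : Set U) : Set (A : Set U)) = S.1 :=
      fun S => by
        rw [Subtype.image_preimage_coe]
        exact Set.inter_eq_right.2 S.2
    refine Order.krullDim_le_of_strictMono (fun S => ⟨(↑) ⁻¹' (S.1 : Set U), ?_,
      S.1.isClosed.preimage continuous_subtype_val⟩) fun S S' h => ?_
    · have := Subtype.irreducibleSpace S.1.isIrreducible
      have hS : (S.1 : Set U) ⊆ (A : Set U) := S.2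
      have := (IrreducibleSpace.isIrreducible_univ (S.1 : Set U)).image (Set.inclusion hS)
        (continuous_inclusion hS).continuousOn
      rwa [Set.image_univ, Set.range_inclusion] at this
    · refine lt_of_le_not_ge (fun x hx => h.le hx) fun hle => h.not_ge ?_
      have := Set.image_mono (f := Subtype.val) (show ((↑) ⁻¹' (S'.1 : Set U) : Set (A : Set U)) ⊆
        (↑) ⁻¹' (S.1 : Set U) from hle)
      rw [him, him] at this
      exact this

private lemma topologicalKrullDim_lt_of_ssubset (hdim : topologicalKrullDim U < ⊤) {A B : Set U}
    (hA : IsIrreducible A) (hAc : IsClosed A) (hB : IsIrreducible B) (hBc : IsClosed B)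
    (h : A ⊂ B) : topologicalKrullDim A < topologicalKrullDim B := by
  let A' : IrreducibleCloseds U := ⟨A, hA, hAc⟩
  let B' : IrreducibleCloseds U := ⟨B, hB, hBc⟩
  have hlt : A' < B' := h
  change topologicalKrullDim (A' : Set U) < topologicalKrullDim (B' : Set U)
  have hfin : topologicalKrullDim (A' : Set U) < ⊤ :=
    (topologicalKrullDim_subspace_le U _).trans_lt hdim
  rw [topologicalKrullDim_eq_height] at hfin
  rw [topologicalKrullDim_eq_height, topologicalKrullDim_eq_height]
  exact WithBot.coe_lt_coe.2 (Order.height_strictMono hlt (WithBot.coe_lt_coe.1 hfin))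

private lemma eq_of_subset_of_topologicalKrullDim_le (hdim : topologicalKrullDim U < ⊤)
    {A B : Set U} (hA : IsIrreducible A) (hAc : IsClosed A) (hB : IsIrreducible B)
    (hBc : IsClosed B) (h : A ⊆ B) (hle : topologicalKrullDim B ≤ topologicalKrullDim A) :
    A = B := by
  by_contra hne
  exact hle.not_gt (topologicalKrullDim_lt_of_ssubset hdim hA hAc hB hBc (h.ssubset_of_ne hne))

end DimensionHelpers

section ComponentHelpers

private lemma exists_common_period {U : Type*} {Φ : U → U} {F : Set (Set U)} (hF : F.Finite)
    (h : ∀ Y ∈ F, IsPeriodicUnder Φ Y) : ∃ n, 1 ≤ n ∧ ∀ Y ∈ F, Set.MapsTo Φ^[n] Y Y := by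
  induction F, hF using Set.Finite.induction_on with
  | empty => exact ⟨1, le_rfl, by simp⟩
  | @insert Y F _ _ ih =>
    obtain ⟨n, hn, hnF⟩ := ih fun Y hY => h Y (Set.mem_insert_of_mem _ hY)
    obtain ⟨m, hm, hmY⟩ := h Y (Set.mem_insert _ _)
    refine ⟨n * m, Nat.mul_pos hn hm, ?_⟩
    rintro Y' (rfl | hY')
    · rw [mul_comm, Function.iterate_mul]
      exact (Set.mapsTo_iff_image_subset.2 hmY).iterate n
    · rw [Function.iterate_mul]
      exact (hnF Y' hY').iterate m

open TopologicalSpace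

variable {U : Type*} [TopologicalSpace U] {Φ : U → U} {Z : Set U}

private lemma exists_finite_irreducible_cover [NoetherianSpace U] (hZ : IsClosed Z) :
    ∃ S : Set (Set U), S.Finite ∧ (∀ s ∈ S, s ⊆ Z ∧ IsIrreducible s ∧ IsClosed s) ∧
      ∀ A, IsIrreducible A → A ⊆ Z → ∃ s ∈ S, A ⊆ s := by
  obtain ⟨S, hSf, hSc, hSi, rfl⟩ := NoetherianSpace.exists_finite_set_isClosed_irreducible hZ
  refine ⟨S, hSf, fun s hs => ⟨Set.subset_sUnion_of_mem hs, hSi s hs, hSc s hs⟩, fun A hA hAZ => ?_⟩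
  obtain ⟨s, hs, h⟩ := isIrreducible_iff_sUnion_isClosed.1 hA hSf.toFinset
    (fun s hs => hSc s (by simpa using hs)) (by simpa using hAZ)
  exact ⟨s, by simpa using hs, h⟩

private lemma maximal_of_mem_irrComps {C : Set U} (hC : C ∈ irrComps Z) :
    Maximal (fun S => S ⊆ Z ∧ IsIrreducible S ∧ IsClosed S) C :=
  hC

private lemma subset_of_mem_irrComps {C : Set U} (hC : C ∈ irrComps Z) : C ⊆ Z :=
  (maximal_of_mem_irrComps hC).prop.1

private lemma isIrreducible_of_mem_irrComps {C : Set U} (hC : C ∈ irrComps Z) :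
    IsIrreducible C :=
  (maximal_of_mem_irrComps hC).prop.2.1

private lemma isClosed_of_mem_irrComps {C : Set U} (hC : C ∈ irrComps Z) : IsClosed C :=
  (maximal_of_mem_irrComps hC).prop.2.2

private lemma finite_irrComps [NoetherianSpace U] (hZ : IsClosed Z) : (irrComps Z).Finite := by
  obtain ⟨S, hSf, hS, hcov⟩ := exists_finite_irreducible_cover hZ
  refine hSf.subset fun C hC => ?_
  obtain ⟨s, hs, h⟩ := hcov C (isIrreducible_of_mem_irrComps hC) (subset_of_mem_irrComps hC)
  rwa [(maximal_of_mem_irrComps hC).eq_of_le (hS s hs) h]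

private lemma exists_irrComps_superset [NoetherianSpace U] (hZ : IsClosed Z) {A : Set U}
    (hA : IsIrreducible A) (hAZ : A ⊆ Z) : ∃ C ∈ irrComps Z, A ⊆ C := by
  obtain ⟨S, hSf, hS, hcov⟩ := exists_finite_irreducible_cover hZ
  obtain ⟨s, hs, hAs⟩ := hcov A hA hAZ
  obtain ⟨C, hsC, hC⟩ := hSf.exists_le_maximal hs
  refine ⟨C, ⟨hS C hC.prop, fun B hB hCB => ?_⟩, hAs.trans hsC⟩
  obtain ⟨t, ht, hBt⟩ := hcov B hB.2.1 hB.1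
  exact hBt.trans (hC.le_of_ge ht (hCB.trans hBt))

private lemma mem_irrComps_of_subset {Z' C : Set U} (hC : C ∈ irrComps Z) (hCZ' : C ⊆ Z')
    (h : Z' ⊆ Z) : C ∈ irrComps Z' :=
  ⟨⟨hCZ', (maximal_of_mem_irrComps hC).prop.2⟩, fun _ hB hCB =>
    (maximal_of_mem_irrComps hC).le_of_ge ⟨hB.1.trans h, hB.2⟩ hCB⟩

private lemma sUnion_subset_PPhi {S : Set (Set U)} (hS : S ⊆ irrComps Z)
    (h : IsPeriodicUnder Φ (⋃₀ S)) : ⋃₀ S ⊆ PPhi Φ Z :=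
  Set.subset_sUnion_of_mem ⟨⟨S, hS, rfl⟩, h⟩

private lemma PPhi_eq_sUnion (Φ : U → U) (Z : Set U) :
    PPhi Φ Z = ⋃₀ {C ∈ irrComps Z | C ⊆ PPhi Φ Z} := by
  apply Set.Subset.antisymm
  · rintro x ⟨Y, ⟨⟨S, hS, rfl⟩, hY⟩, C, hC, hx⟩
    exact ⟨C, ⟨hS hC, (Set.subset_sUnion_of_mem hC).trans (sUnion_subset_PPhi hS hY)⟩, hx⟩
  · exact Set.sUnion_subset fun C hC => hC.2

private lemma isPeriodicUnder_PPhi [NoetherianSpace U] (Φ : U → U) (hZ : IsClosed Z) :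
    ∃ n, 1 ≤ n ∧ Set.MapsTo Φ^[n] (PPhi Φ Z) (PPhi Φ Z) := by
  have hfin : {Y : Set U | (∃ S ⊆ irrComps Z, Y = ⋃₀ S) ∧ IsPeriodicUnder Φ Y}.Finite := by
    refine ((finite_irrComps hZ).finite_subsets.image Set.sUnion).subset ?_
    rintro _ ⟨⟨S, hS, rfl⟩, -⟩
    exact ⟨S, hS, rfl⟩
  obtain ⟨n, hn, h⟩ := exists_common_period hfin fun Y hY => hY.2
  refine ⟨n, hn, ?_⟩
  rintro x ⟨Y, hY, hx⟩
  exact ⟨Y, hY, h Y hY hx⟩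

private lemma not_image_subset_self {C : Set U} (hC : C ∈ nonPeriodicComps Φ Z) {j : ℕ}
    (hj : 1 ≤ j) : ¬ Φ^[j] '' C ⊆ C := fun h => by
  refine hC.2 ?_
  have := sUnion_subset_PPhi (Φ := Φ) (S := {C}) (by simpa using hC.1)
    (by rw [Set.sUnion_singleton]; exact ⟨j, hj, h⟩)
  rwa [Set.sUnion_singleton] at this

private lemma not_image_subset_PPhi {C : Set U} (hC : C ∈ nonPeriodicComps Φ Z) {j : ℕ}
    (hj : 1 ≤ j) (hP : Set.MapsTo Φ^[j] (PPhi Φ Z) (PPhi Φ Z)) : ¬ Φ^[j] '' C ⊆ PPhi Φ Z := by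
  intro h
  have hS : insert C {C ∈ irrComps Z | C ⊆ PPhi Φ Z} ⊆ irrComps Z :=
    Set.insert_subset hC.1 fun _ hB => hB.1
  have := sUnion_subset_PPhi (Φ := Φ) hS <| by
    rw [Set.sUnion_insert, ← PPhi_eq_sUnion]
    refine ⟨j, hj, ?_⟩
    rw [Set.image_union]
    exact (Set.union_subset h hP.image_subset).trans Set.subset_union_right
  exact hC.2 ((Set.subset_sUnion_of_mem (Set.mem_insert _ _)).trans this)

end ComponentHelpers

section StableDimensionHelpers

open TopologicalSpace

variable {U : Type*} [TopologicalSpace U] {Φ : U → U} {Z : Set U}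

private lemma stabDim_mono {A B : Set U} (h : A ⊆ B) : stabDim Φ A ≤ stabDim Φ B :=
  iInf_mono fun _ => topologicalKrullDim_mono (closure_mono (Set.image_mono h))

private lemma exists_topologicalKrullDim_eq_stabDim (Φ : U → U) (C : Set U) :
    ∃ m : ℕ, topologicalKrullDim (closure (Φ^[m] '' C)) = stabDim Φ C :=
  ciInf_mem fun n : ℕ => topologicalKrullDim (closure (Φ^[n] '' C))

private lemma stabDim_le_of_image_subset {A B : Set U} {j : ℕ} (h : Φ^[j] '' A ⊆ B) :
    stabDim Φ A ≤ stabDim Φ B := by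
  refine le_iInf fun n => (iInf_le _ (n + j)).trans ?_
  refine topologicalKrullDim_mono (closure_mono ?_)
  rw [Function.iterate_add, Set.image_comp]
  exact Set.image_mono h

/-- If `Φ^j(A) ⊆ B` for infinitely many `j`, where `A` and `B` have the same stable dimension,
then `B` is periodic. -/
private lemma exists_image_subset_self (hdim : topologicalKrullDim U < ⊤) (hΦ : Continuous Φ)
    {A B : Set U} (hA : IsIrreducible A) (hB : IsIrreducible B) (hBc : IsClosed B)
    (hAB : stabDim Φ B ≤ stabDim Φ A) (hinf : {j | Φ^[j] '' A ⊆ B}.Infinite) :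
    ∃ n, 1 ≤ n ∧ Φ^[n] '' B ⊆ B := by
  obtain ⟨m, hm⟩ := exists_topologicalKrullDim_eq_stabDim Φ B
  have hirr : ∀ (C : Set U) (n : ℕ), IsIrreducible C → IsIrreducible (closure (Φ^[n] '' C)) :=
    fun C n hC => (hC.image _ (hΦ.iterate n).continuousOn).closure
  obtain ⟨j₀, hj₀⟩ := hinf.nonempty
  obtain ⟨j₁, hj₁, hlt⟩ := hinf.exists_gt (m + j₀)
  have heq : closure (Φ^[m + j₀] '' A) = closure (Φ^[m] '' B) := by
    refine eq_of_subset_of_topologicalKrullDim_le hdim (hirr _ _ hA) isClosed_closure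
      (hirr _ _ hB) isClosed_closure (closure_mono ?_) ?_
    · rw [Function.iterate_add, Set.image_comp]
      exact Set.image_mono hj₀
    · rw [hm]
      exact hAB.trans (iInf_le _ _)
  refine ⟨j₁ - j₀, by omega, ?_⟩
  obtain ⟨r, rfl⟩ : ∃ r, j₁ = r + (m + j₀) := ⟨j₁ - (m + j₀), by omega⟩
  rw [show r + (m + j₀) - j₀ = r + m by omega, Function.iterate_add, Set.image_comp]
  calc Φ^[r] '' (Φ^[m] '' B) ⊆ Φ^[r] '' closure (Φ^[m + j₀] '' A) := by
        rw [heq]; exact Set.image_mono subset_closure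
    _ ⊆ closure (Φ^[r] '' (Φ^[m + j₀] '' A)) := image_closure_subset_closure_image (hΦ.iterate r)
    _ ⊆ B := by
        refine closure_minimal ?_ hBc
        rw [← Set.image_comp, ← Function.iterate_add]
        exact hj₁

/-- A component of maximal stable dimension returns to `Z` along only finitely many multiples of
a period of `P_Φ(Z)`. -/
private lemma finite_return_set [NoetherianSpace U] (hdim : topologicalKrullDim U < ⊤)
    (hΦ : Continuous Φ) (hZ : IsClosed Z) {n : ℕ}
    (hP : Set.MapsTo Φ^[n] (PPhi Φ Z) (PPhi Φ Z)) {C : Set U} (hC : C ∈ nonPeriodicComps Φ Z)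
    (hmax : ∀ B ∈ nonPeriodicComps Φ Z, stabDim Φ B ≤ stabDim Φ C) :
    {j | 1 ≤ j ∧ n ∣ j ∧ Φ^[j] '' C ⊆ Z}.Finite := by
  have hfin : (⋃ B ∈ nonPeriodicComps Φ Z, {j | Φ^[j] '' C ⊆ B}).Finite := by
    refine ((finite_irrComps hZ).subset fun B hB => hB.1).biUnion fun B hB => ?_
    by_contra hinf
    obtain ⟨r, hr, h⟩ := exists_image_subset_self hdim hΦ
      (isIrreducible_of_mem_irrComps hC.1) (isIrreducible_of_mem_irrComps hB.1)
      (isClosed_of_mem_irrComps hB.1) (hmax B hB) hinf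
    exact not_image_subset_self hB hr h
  refine hfin.subset ?_
  rintro j ⟨hj, ⟨r, rfl⟩, hjZ⟩
  obtain ⟨B, hB, hCB⟩ := exists_irrComps_superset hZ
    ((isIrreducible_of_mem_irrComps hC.1).image _ (hΦ.iterate (n * r)).continuousOn) hjZ
  refine Set.mem_biUnion (show B ∈ nonPeriodicComps Φ Z from ⟨hB, fun hBP => ?_⟩) hCB
  refine not_image_subset_PPhi hC hj ?_ (hCB.trans hBP)
  rw [Function.iterate_mul]
  exact hP.iterate r

/-- If `Φ^j` preserves `P_Φ(Z)`, then every non-periodic component of `Z ∩ Φ^{-j}(Z)` lies in a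
non-periodic component of `Z`. -/
private lemma exists_nonPeriodicComps_superset [NoetherianSpace U] (hZ : IsClosed Z) {j : ℕ}
    (hP : Set.MapsTo Φ^[j] (PPhi Φ Z) (PPhi Φ Z)) {C : Set U}
    (hC : C ∈ nonPeriodicComps Φ (Z ∩ Φ^[j] ⁻¹' Z)) : ∃ B ∈ nonPeriodicComps Φ Z, C ⊆ B := by
  obtain ⟨B, hB, hCB⟩ := exists_irrComps_superset hZ (isIrreducible_of_mem_irrComps hC.1)
    ((subset_of_mem_irrComps hC.1).trans Set.inter_subset_left)
  refine ⟨B, ⟨hB, fun hBP => hC.2 ?_⟩, hCB⟩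
  have hPZ : PPhi Φ Z ⊆ Z := by
    rw [PPhi_eq_sUnion]
    exact Set.sUnion_subset fun B hB => (subset_of_mem_irrComps hB.1)
  have hPZ' : PPhi Φ Z ⊆ Z ∩ Φ^[j] ⁻¹' Z := fun x hx => ⟨hPZ hx, hPZ (hP hx)⟩
  obtain ⟨n, hn, hper⟩ := isPeriodicUnder_PPhi Φ hZ
  refine (hCB.trans hBP).trans ?_
  rw [PPhi_eq_sUnion]
  refine sUnion_subset_PPhi
    (fun B hB => mem_irrComps_of_subset hB.1 (hB.2.trans hPZ') Set.inter_subset_left) ?_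
  rw [← PPhi_eq_sUnion]
  exact ⟨n, hn, hper.image_subset⟩

private lemma nuLt_of_not_image_subset [NoetherianSpace U] (hdim : topologicalKrullDim U < ⊤)
    (hΦ : Continuous Φ) (hZ : IsClosed Z) (hNP : (nonPeriodicComps Φ Z).Nonempty) {j : ℕ}
    (hP : Set.MapsTo Φ^[j] (PPhi Φ Z) (PPhi Φ Z))
    (hj : ∀ C ∈ nonPeriodicComps Φ Z, (∀ B ∈ nonPeriodicComps Φ Z, stabDim Φ B ≤ stabDim Φ C) →
      ¬ Φ^[j] '' C ⊆ Z) :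
    nuLt (nuDim Φ (Z ∩ Φ^[j] ⁻¹' Z)) (nuDim Φ Z) := by
  classical
  have hZ' : IsClosed (Z ∩ Φ^[j] ⁻¹' Z) := hZ.inter (hZ.preimage (hΦ.iterate j))
  have hle : (nuDim Φ (Z ∩ Φ^[j] ⁻¹' Z)).1 ≤ (nuDim Φ Z).1 := by
    refine iSup₂_le fun C hC => ?_
    obtain ⟨B, hB, hCB⟩ := exists_nonPeriodicComps_superset hZ hP hC
    exact (stabDim_mono hCB).trans (le_iSup₂ (f := fun C _ => stabDim Φ C) B hB)
  refine hle.lt_or_eq.imp_right fun heq => ⟨heq, ?_⟩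
  have hD : ∀ B ∈ nonPeriodicComps Φ Z, stabDim Φ B ≤ (nuDim Φ Z).1 :=
    fun B hB => le_iSup₂ (f := fun C _ => stabDim Φ C) B hB
  have hE : ∀ B ∈ nonPeriodicComps Φ Z, stabDim Φ B = (nuDim Φ Z).1 →
      topologicalKrullDim B ≤ (nuDim Φ Z).2 := fun B hB h => by
    refine le_trans ?_ (le_iSup₂ (f := fun C _ => if stabDim Φ C = (nuDim Φ Z).1 then
      topologicalKrullDim C else ⊥) B hB)
    rw [if_pos h]
  have hpos : ⊥ < (nuDim Φ Z).2 := by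
    obtain ⟨C, hC, hmax⟩ := ((finite_irrComps hZ).subset fun B
      (hB : B ∈ nonPeriodicComps Φ Z) => hB.1).exists_maximalFor (stabDim Φ) _ hNP
    have hCD : stabDim Φ C = (nuDim Φ Z).1 :=
      (hD C hC).antisymm (iSup₂_le fun B hB => (le_total _ _).elim id (hmax hB))
    refine lt_of_lt_of_le ?_ (hE C hC hCD)
    let C' : IrreducibleCloseds U :=
      ⟨C, isIrreducible_of_mem_irrComps hC.1, isClosed_of_mem_irrComps hC.1⟩
    rw [show C = (C' : Set U) from rfl, topologicalKrullDim_eq_height]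
    exact WithBot.bot_lt_coe _
  have hfin : (nonPeriodicComps Φ (Z ∩ Φ^[j] ⁻¹' Z)).Finite :=
    (finite_irrComps hZ').subset fun B hB => hB.1
  change (⨆ C ∈ nonPeriodicComps Φ (Z ∩ Φ^[j] ⁻¹' Z),
    if stabDim Φ C = (nuDim Φ (Z ∩ Φ^[j] ⁻¹' Z)).1 then topologicalKrullDim C else ⊥) < _
  rw [heq]
  simp_rw [← hfin.mem_toFinset]
  rw [← Finset.sup_eq_iSup, Finset.sup_lt_iff hpos]
  intro C hC
  rw [hfin.mem_toFinset] at hC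
  split_ifs with hCD
  · obtain ⟨B, hB, hCB⟩ := exists_nonPeriodicComps_superset hZ hP hC
    have hBD : stabDim Φ B = (nuDim Φ Z).1 := (hD B hB).antisymm (hCD ▸ stabDim_mono hCB)
    refine lt_of_lt_of_le ?_ (hE B hB hBD)
    refine topologicalKrullDim_lt_of_ssubset hdim (isIrreducible_of_mem_irrComps hC.1)
      (isClosed_of_mem_irrComps hC.1) (isIrreducible_of_mem_irrComps hB.1)
      (isClosed_of_mem_irrComps hB.1) (hCB.ssubset_of_ne ?_)
    rintro rfl
    refine hj C hB (fun B hB => (hD B hB).trans_eq hBD.symm) ?_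
    exact Set.image_subset_iff.2 ((subset_of_mem_irrComps hC.1).trans Set.inter_subset_right)
  · exact hpos

end StableDimensionHelpers

/-- **Proposition 3.8 of Bell–Hu–Satriano**: let `U` be a Noetherian topological space of
finite Krull dimension and `Φ : U → U` a continuous map. Suppose `T ⊆ ℕ` has positive
upper asymptotic density and `Z ⊆ U` is closed with `N_Φ(Z) ≠ ∅`. Then there exist
infinitely many `j ∈ Σ(T)` with `ν(Z ∩ Φ^{−j}(Z)) ≺ ν(Z)`. -/
theorem strictly_decreasing_nu
    {U : Type*} [TopologicalSpace U] [TopologicalSpace.NoetherianSpace U]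
    (hdim : topologicalKrullDim U < ⊤)
    (Φ : U → U) (hΦ : Continuous Φ)
    (T : Set ℕ) (hT : 0 < upperDensity T)
    (Z : Set U) (hZ : IsClosed Z) (hNP : (NPhi Φ Z).Nonempty) :
    {j ∈ shiftSet T | nuLt (nuDim Φ (Z ∩ Φ^[j] ⁻¹' Z)) (nuDim Φ Z)}.Infinite := by
  obtain ⟨n, hn, hP⟩ := isPeriodicUnder_PPhi Φ hZ
  have hNP' : (nonPeriodicComps Φ Z).Nonempty := by
    obtain ⟨x, C, hC, -⟩ := hNP
    exact ⟨C, hC⟩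
  have hfin : (⋃ C ∈ {C ∈ nonPeriodicComps Φ Z | ∀ B ∈ nonPeriodicComps Φ Z,
      stabDim Φ B ≤ stabDim Φ C}, {j | 1 ≤ j ∧ n ∣ j ∧ Φ^[j] '' C ⊆ Z}).Finite :=
    ((finite_irrComps hZ).subset fun B hB => hB.1.1).biUnion fun C hC =>
      finite_return_set hdim hΦ hZ hP hC.1 hC.2
  refine ((infinite_dvd_mem_shiftSet hT hn).sdiff
    (hfin.union (Set.finite_singleton 0))).mono ?_
  rintro j ⟨⟨hjT, hnj⟩, hj⟩
  rw [Set.mem_union, not_or] at hj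
  have hj1 : 1 ≤ j := Nat.one_le_iff_ne_zero.2 hj.2
  have hPj : Set.MapsTo Φ^[j] (PPhi Φ Z) (PPhi Φ Z) := by
    obtain ⟨r, rfl⟩ := hnj
    rw [Function.iterate_mul]
    exact hP.iterate r
  refine ⟨hjT, nuLt_of_not_image_subset hdim hΦ hZ hNP' hPj fun C hC hmax hCZ => hj.1 ?_⟩
  exact Set.mem_biUnion (show C ∈ {C ∈ nonPeriodicComps Φ Z | _} from ⟨hC, hmax⟩)
    ⟨hj1, hnj, hCZ⟩
end
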